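/- arXiv:2007.07733 — 2 statements merged into one kernel-verified Lean document; each statement's English description precedes it below -/
import Mathlib

section
/- Let F : ℝ² → ℝ be twice continuously differentiable, and fix constants v, c1, c2, c3, c4 > 0, s_d ∈ ℝ, t0 ∈ ℝ. Let (p, θ, σ) : [t0, ∞) → ℝ² × ℝ × ℝ be differentiable and satisfy the Dubins closed loop ṗ(t) = v(cos θ(t), sin θ(t)), θ̇(t) = c1·e(t) + c2·σ(t), σ̇(t) = e(t), where e(t) = (d/dt)F(p(t)) + c3 tanh((F(p(t)) - s_d)/c4). Let (p2, u, σ2) : [t0, ∞) → ℝ² × ℝ² × ℝ be differentiable and satisfy the double-integrator closed loop ṗ2(t) = u(t), u̇(t) = ω2(t)·(-u_y(t), u_x(t)), σ̇2(t) = e2(t), where u = (u_x, u_y), e2(t) = (d/dt)F(p2(t)) + c3 tanh((F(p2(t)) - s_d)/c4), and ω2(t) = c1·e2(t) + c2·σ2(t). If p(t0) = p2(t0), u(t0) = v(cos θ(t0), sin θ(t0)), and σ(t0) = σ2(t0), then for all t ≥ t0: p2(t) = p(t) and u(t) = v(cos θ(t), sin θ(t)); in particular ‖u(t)‖ = v for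 all t. -/
open Real

theorem contDiff_real_tanh {n : WithTop ℕ∞} : ContDiff ℝ n Real.tanh := by
  have h : Real.tanh = fun x => Real.sinh x / Real.cosh x :=
    funext Real.tanh_eq_sinh_div_cosh
  rw [h]
  exact Real.contDiff_sinh.div Real.contDiff_cosh fun x => (Real.cosh_pos x).ne'

/-- Two forward solutions of an autonomous `C¹` differential equation which agree at the initial
time agree at all later times. -/
theorem eq_of_hasDerivAt_of_contDiff {E : Type*} [NormedAddCommGroup E] [NormedSpace ℝ E]
    {f : E → E} (hf : ContDiff ℝ 1 f) {x y : ℝ → E} {t₀ : ℝ}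
    (hx : ∀ t, t₀ ≤ t → HasDerivAt x (f (x t)) t)
    (hy : ∀ t, t₀ ≤ t → HasDerivAt y (f (y t)) t) (h₀ : x t₀ = y t₀)
    {t : ℝ} (ht : t₀ ≤ t) : x t = y t := by
  have hxc : ContinuousOn x (Set.Icc t₀ t) :=
    fun s hs => (hx s hs.1).continuousAt.continuousWithinAt
  have hyc : ContinuousOn y (Set.Icc t₀ t) :=
    fun s hs => (hy s hs.1).continuousAt.continuousWithinAt
  obtain ⟨K, hK⟩ := (hf.locallyLipschitz.locallyLipschitzOn
    (s := x '' Set.Icc t₀ t ∪ y '' Set.Icc t₀ t)).exists_lipschitzOnWith_of_compact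
    ((isCompact_Icc.image_of_continuousOn hxc).union (isCompact_Icc.image_of_continuousOn hyc))
  exact ODE_solution_unique_of_mem_Icc_right (v := fun _ => f)
    (s := fun _ => x '' Set.Icc t₀ t ∪ y '' Set.Icc t₀ t) (fun _ _ => hK)
    hxc (fun s hs => (hx s hs.1).hasDerivWithinAt)
    (fun s hs => Or.inl ⟨s, Set.Ico_subset_Icc_self hs, rfl⟩)
    hyc (fun s hs => (hy s hs.1).hasDerivWithinAt)
    (fun s hs => Or.inr ⟨s, Set.Ico_subset_Icc_self hs, rfl⟩) h₀ ⟨ht, le_rfl⟩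

/-- The error signal `ṡ + c₃ tanh ((s - s_d) / c₄)` as a function of position and velocity. -/
noncomputable def trackingError (F : ℝ × ℝ → ℝ) (c3 c4 sd : ℝ) (q w : ℝ × ℝ) : ℝ :=
  fderiv ℝ F q w + c3 * Real.tanh ((F q - sd) / c4)

/-- The closed-loop vector field on states `(position, velocity, integral of the error)`. -/
noncomputable def closedLoopField (F : ℝ × ℝ → ℝ) (c1 c2 c3 c4 sd : ℝ)
    (x : (ℝ × ℝ) × (ℝ × ℝ) × ℝ) : (ℝ × ℝ) × (ℝ × ℝ) × ℝ :=
  (x.2.1,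
    ((c1 * trackingError F c3 c4 sd x.1 x.2.1 + c2 * x.2.2) * (-x.2.1.2),
      (c1 * trackingError F c3 c4 sd x.1 x.2.1 + c2 * x.2.2) * x.2.1.1),
    trackingError F c3 c4 sd x.1 x.2.1)

theorem contDiff_closedLoopField {F : ℝ × ℝ → ℝ} (hF : ContDiff ℝ 2 F) (c1 c2 c3 c4 sd : ℝ) :
    ContDiff ℝ 1 (closedLoopField F c1 c2 c3 c4 sd) := by
  have hF1 : ContDiff ℝ 1 F := hF.of_le one_le_two
  have hD : ContDiff ℝ 1 (fderiv ℝ F) := hF.fderiv_right (by norm_num)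
  have he : ContDiff ℝ 1 fun x : (ℝ × ℝ) × (ℝ × ℝ) × ℝ =>
      trackingError F c3 c4 sd x.1 x.2.1 := by
    unfold trackingError
    exact ((hD.comp contDiff_fst).clm_apply (by fun_prop)).add
      (contDiff_const.mul (contDiff_real_tanh.comp
        (((hF1.comp contDiff_fst).sub contDiff_const).div_const c4)))
  unfold closedLoopField
  fun_prop

/-- The error signal along a trajectory is the tracking error of its position and velocity. -/
theorem eq_trackingError {F : ℝ × ℝ → ℝ} (hF : Differentiable ℝ F) {c3 c4 sd ds t : ℝ}
    {q : ℝ → ℝ × ℝ} {w : ℝ × ℝ} (hq : HasDerivAt q w t)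
    (hds : HasDerivAt (fun τ => F (q τ)) ds t) :
    ds + c3 * Real.tanh ((F (q t) - sd) / c4) = trackingError F c3 c4 sd (q t) w := by
  rw [trackingError, hds.unique ((hF (q t)).hasFDerivAt.comp_hasDerivAt t hq)]

/-- Trajectory identity of a Dubins vehicle under the PI-like controller and a
double-integrator vehicle under the orthogonal-acceleration controller: with
matching initial states, the positions and velocities coincide for all time, and
in particular the double-integrator's speed equals `v`. -/
theorem stmt_8 (F : ℝ × ℝ → ℝ) (hF : ContDiff ℝ 2 F)
    (v c1 c2 c3 c4 sd t0 : ℝ)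
    (hv : 0 < v) (hc1 : 0 < c1) (hc2 : 0 < c2) (hc3 : 0 < c3) (hc4 : 0 < c4)
    -- Dubins vehicle under the PI-like controller
    (p : ℝ → ℝ × ℝ) (θ σ : ℝ → ℝ) (ds e : ℝ → ℝ)
    (hp : ∀ t : ℝ, t0 ≤ t →
      HasDerivAt p (v * Real.cos (θ t), v * Real.sin (θ t)) t)
    (hds : ∀ t : ℝ, t0 ≤ t → HasDerivAt (fun τ => F (p τ)) (ds t) t)
    (he : ∀ t : ℝ, e t = ds t + c3 * Real.tanh ((F (p t) - sd) / c4))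
    (hθ : ∀ t : ℝ, t0 ≤ t → HasDerivAt θ (c1 * e t + c2 * σ t) t)
    (hσ : ∀ t : ℝ, t0 ≤ t → HasDerivAt σ (e t) t)
    -- double-integrator vehicle under the orthogonal-acceleration controller
    (p2 : ℝ → ℝ × ℝ) (u : ℝ → ℝ × ℝ) (σ2 : ℝ → ℝ) (ds2 e2 ω2 : ℝ → ℝ)
    (hp2 : ∀ t : ℝ, t0 ≤ t → HasDerivAt p2 (u t) t)
    (hds2 : ∀ t : ℝ, t0 ≤ t → HasDerivAt (fun τ => F (p2 τ)) (ds2 t) t)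
    (he2 : ∀ t : ℝ, e2 t = ds2 t + c3 * Real.tanh ((F (p2 t) - sd) / c4))
    (hω2 : ∀ t : ℝ, ω2 t = c1 * e2 t + c2 * σ2 t)
    (hu : ∀ t : ℝ, t0 ≤ t →
      HasDerivAt u (ω2 t * (-(u t).2), ω2 t * (u t).1) t)
    (hσ2 : ∀ t : ℝ, t0 ≤ t → HasDerivAt σ2 (e2 t) t)
    -- identical initial states
    (hinit : p t0 = p2 t0 ∧ u t0 = (v * Real.cos (θ t0), v * Real.sin (θ t0)) ∧
      σ t0 = σ2 t0) :
    ∀ t : ℝ, t0 ≤ t →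
      p2 t = p t ∧ u t = (v * Real.cos (θ t), v * Real.sin (θ t)) ∧
      Real.sqrt ((u t).1 ^ 2 + (u t).2 ^ 2) = v := by
  have hFd : Differentiable ℝ F := hF.differentiable (by norm_num)
  have hx : ∀ t, t0 ≤ t → HasDerivAt
      (fun τ => (p τ, (v * Real.cos (θ τ), v * Real.sin (θ τ)), σ τ))
      (closedLoopField F c1 c2 c3 c4 sd
        (p t, (v * Real.cos (θ t), v * Real.sin (θ t)), σ t)) t := by
    intro t ht
    have hE := (he t).trans (eq_trackingError hFd (hp t ht) (hds t ht))
    have hcos := ((hθ t ht).cos).const_mul v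
    have hsin := ((hθ t ht).sin).const_mul v
    convert (hp t ht).prodMk ((hcos.prodMk hsin).prodMk (hσ t ht)) using 1
    simp only [closedLoopField, ← hE, Prod.mk.injEq, true_and, and_true]
    constructor <;> ring
  have hy : ∀ t, t0 ≤ t → HasDerivAt (fun τ => (p2 τ, u τ, σ2 τ))
      (closedLoopField F c1 c2 c3 c4 sd (p2 t, u t, σ2 t)) t := by
    intro t ht
    have hE := (he2 t).trans (eq_trackingError hFd (hp2 t ht) (hds2 t ht))
    convert (hp2 t ht).prodMk ((hu t ht).prodMk (hσ2 t ht)) using 1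
    simp only [closedLoopField, ← hE, hω2]
  intro t ht
  have key := eq_of_hasDerivAt_of_contDiff (contDiff_closedLoopField hF c1 c2 c3 c4 sd) hy hx
    (by rw [hinit.1, hinit.2.1, hinit.2.2]) ht
  simp only [Prod.mk.injEq] at key
  obtain ⟨hpt, hut, -⟩ := key
  refine ⟨hpt, hut, ?_⟩
  rw [hut, Real.sqrt_eq_iff_mul_self_eq_of_pos hv]
  linear_combination (-v ^ 2) * Real.sin_sq_add_cos_sq (θ t)
end

section
/- Fix constants v, α, r_d, c4 > 0, c1 > 0, 0 < c3 < αv, s_d ∈ ℝ, and t0 ∈ ℝ. Let r, φ : [t0, ∞) → ℝ be differentiable with r(t) > 0 for all t ≥ t0, satisfying ṙ(t) = v cos φ(t) and φ̇(t) = c1(-αv cos φ(t) - c3 tanh(α(r(t) - r_d)/c4)) - (v/r(t)) sin φ(t) for all t ≥ t0, and set s(t) = s_d - α(r(t) - r_d). Let r_e be the unique positive root of g(r) = -tanh(α(r - r_d)/c4) + v/(c1·c3·r) and s_e = s_d - α(r_e - r_d). If φ(t0) ∈ [-π, 0], then s(t) → s_e and ṡ(t) → 0 as t → ∞. -/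
open Real Filter

section Calculus

theorem monotoneOn_Ici_of_hasDerivAt {f f' : ℝ → ℝ} {a : ℝ}
    (hf : ∀ t, a ≤ t → HasDerivAt f (f' t) t) (hf' : ∀ t, a ≤ t → 0 ≤ f' t) :
    MonotoneOn f (Set.Ici a) :=
  monotoneOn_of_hasDerivWithinAt_nonneg (f' := f') (convex_Ici a)
    (fun t ht => (hf t ht).continuousAt.continuousWithinAt)
    (fun t ht => (hf t (interior_subset ht)).hasDerivWithinAt)
    (fun t ht => hf' t (interior_subset ht))

theorem antitoneOn_Ici_of_hasDerivAt {f f' : ℝ → ℝ} {a : ℝ}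
    (hf : ∀ t, a ≤ t → HasDerivAt f (f' t) t) (hf' : ∀ t, a ≤ t → f' t ≤ 0) :
    AntitoneOn f (Set.Ici a) := by
  have := monotoneOn_Ici_of_hasDerivAt (f := fun t => -f t) (f' := fun t => -f' t) (a := a)
    (fun t ht => (hf t ht).fun_neg) (fun t ht => neg_nonneg.2 (hf' t ht))
  intro x hx y hy hxy
  exact neg_le_neg_iff.1 (this hx hy hxy)

/-- A function decreasing on `(0, a]` and increasing on `[a, ∞)` is minimal at `a`. -/
theorem le_of_hasDerivAt_of_sign {F F' : ℝ → ℝ} {a : ℝ} (ha : 0 < a)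
    (hF : ∀ x, 0 < x → HasDerivAt F (F' x) x)
    (hneg : ∀ x, 0 < x → x ≤ a → F' x ≤ 0) (hpos : ∀ x, a ≤ x → 0 ≤ F' x)
    {x : ℝ} (hx : 0 < x) : F a ≤ F x := by
  rcases le_total a x with h | h
  · exact monotoneOn_Ici_of_hasDerivAt (fun t ht => hF t (ha.trans_le ht)) hpos
      Set.self_mem_Ici h h
  · have hanti : AntitoneOn F (Set.Icc x a) :=
      antitoneOn_of_hasDerivWithinAt_nonpos (f' := F') (convex_Icc x a)
        (fun t ht => (hF t (hx.trans_le ht.1)).continuousAt.continuousWithinAt)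
        (fun t ht => (hF t (hx.trans_le (interior_subset ht).1)).hasDerivWithinAt)
        (fun t ht => hneg t (hx.trans_le (interior_subset ht).1) (interior_subset ht).2)
    exact hanti (Set.left_mem_Icc.2 h) (Set.right_mem_Icc.2 h) h

/-- A barrier: a function pushed strictly down wherever it equals `c` cannot cross `c` upwards. -/
theorem le_const_of_hasDerivAt_neg {f f' : ℝ → ℝ} {a c : ℝ}
    (hf : ∀ t, a ≤ t → HasDerivAt f (f' t) t) (ha : f a ≤ c)
    (hc : ∀ t, a ≤ t → f t = c → f' t < 0) {t : ℝ} (ht : a ≤ t) : f t ≤ c :=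
  image_le_of_deriv_right_lt_deriv_boundary' (f := f) (f' := f') (a := a) (b := t)
    (B := fun _ => c) (B' := fun _ => 0)
    (fun x hx => (hf x hx.1).continuousAt.continuousWithinAt)
    (fun x hx => (hf x hx.1).hasDerivWithinAt) ha continuousOn_const
    (fun x _ => hasDerivWithinAt_const x _ c) (fun x hx => hc x hx.1)
    (Set.right_mem_Icc.2 ht)

/-- Barbalat's lemma: if `f` converges at infinity and has a bounded second derivative, then
`f'` tends to zero. -/
theorem tendsto_deriv_zero_of_bounded_second_deriv {f f' f'' : ℝ → ℝ} {a M L : ℝ}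
    (hf : ∀ t, a ≤ t → HasDerivAt f (f' t) t) (hf' : ∀ t, a ≤ t → HasDerivAt f' (f'' t) t)
    (hM : ∀ t, a ≤ t → |f'' t| ≤ M) (hL : Tendsto f atTop (nhds L)) :
    Tendsto f' atTop (nhds 0) := by
  have hM0 : 0 ≤ M := (abs_nonneg _).trans (hM a le_rfl)
  have key : ∀ t, a ≤ t → ∀ h, 0 < h → |f (t + h) - f t - h * f' t| ≤ M * h * h := by
    intro t ht h hh
    have hlip : ∀ y ∈ Set.Icc t (t + h), ‖f' y - f' t‖ ≤ M * h := by
      intro y hy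
      have := (convex_Icc t (t + h)).norm_image_sub_le_of_norm_hasDerivWithin_le
        (f := f') (f' := f'') (C := M)
        (fun x hx => (hf' x (ht.trans hx.1)).hasDerivWithinAt)
        (fun x hx => hM x (ht.trans hx.1))
        (Set.left_mem_Icc.2 (by linarith)) hy
      refine this.trans (mul_le_mul_of_nonneg_left ?_ hM0)
      rw [Real.norm_eq_abs, abs_of_nonneg (by linarith [hy.1])]
      linarith [hy.2]
    have := (convex_Icc t (t + h)).norm_image_sub_le_of_norm_hasDerivWithin_le
      (f := fun y => f y - y * f' t) (f' := fun y => f' y - f' t) (C := M * h)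
      (fun x hx => by
        have := (hf x (ht.trans hx.1)).fun_sub ((hasDerivAt_id' x).mul_const (f' t))
        simpa using this.hasDerivWithinAt)
      hlip (Set.left_mem_Icc.2 (by linarith)) (Set.right_mem_Icc.2 (by linarith))
    simp only [Real.norm_eq_abs, add_sub_cancel_left, abs_of_pos hh] at this
    convert this using 2
    ring
  rw [Metric.tendsto_atTop]
  intro ε hε
  set h := ε / (2 * (M + 1)) with hdef
  have hh : 0 < h := by positivity
  have hMh : M * h < ε / 2 := by
    rw [hdef, ← mul_div_assoc, div_lt_div_iff₀ (by positivity) (by norm_num)]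
    nlinarith
  obtain ⟨N, hN⟩ := Metric.tendsto_atTop.1 hL (h * ε / 4) (by positivity)
  refine ⟨max N a, fun t ht => ?_⟩
  have hta : a ≤ t := (le_max_right _ _).trans ht
  have htN : N ≤ t := (le_max_left _ _).trans ht
  have h1 := hN t htN
  have h2 := hN (t + h) (by linarith)
  have h3 := key t hta h hh
  rw [Real.dist_eq] at h1 h2 ⊢
  rw [sub_zero]
  rw [abs_lt] at h1 h2
  rw [abs_le] at h3
  have h4 : M * h * h < ε / 2 * h := mul_lt_mul_of_pos_right hMh hh
  rw [abs_lt]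
  constructor
  · refine lt_of_mul_lt_mul_left (a := h) ?_ hh.le
    linarith [h1.1, h1.2, h2.1, h2.2, h3.1, h3.2]
  · refine lt_of_mul_lt_mul_left (a := h) ?_ hh.le
    linarith [h1.1, h1.2, h2.1, h2.2, h3.1, h3.2]

theorem exists_tendsto_of_antitoneOn_Ici {f : ℝ → ℝ} {a m : ℝ}
    (hf : AntitoneOn f (Set.Ici a)) (hm : ∀ t, a ≤ t → m ≤ f t) :
    ∃ L, Tendsto f atTop (nhds L) := by
  have hanti : Antitone fun t => f (max t a) := fun x y hxy =>
    hf (le_max_right x a) (le_max_right y a) (max_le_max_right a hxy)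
  have hbdd : BddBelow (Set.range fun t => f (max t a)) :=
    ⟨m, by rintro _ ⟨t, rfl⟩; exact hm _ (le_max_right _ _)⟩
  refine ⟨_, (tendsto_atTop_ciInf hanti hbdd).congr' ?_⟩
  filter_upwards [eventually_ge_atTop a] with t ht
  rw [max_eq_left ht]

theorem exists_hasDerivAt_of_continuous {f : ℝ → ℝ} (hf : Continuous f) (a : ℝ) :
    ∃ F : ℝ → ℝ, F a = 0 ∧ ∀ x, HasDerivAt F (f x) x :=
  ⟨fun x => ∫ y in a..x, f y, intervalIntegral.integral_same, fun x =>
    intervalIntegral.integral_hasDerivAt_right (hf.intervalIntegrable a x)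
      (hf.stronglyMeasurableAtFilter _ _) hf.continuousAt⟩

theorem hasDerivAt_real_tanh (x : ℝ) :
    HasDerivAt Real.tanh (1 / Real.cosh x ^ 2) x := by
  have h := (Real.hasDerivAt_sinh x).fun_div (Real.hasDerivAt_cosh x) (Real.cosh_pos x).ne'
  have heq : Real.tanh = fun y => Real.sinh y / Real.cosh y :=
    funext Real.tanh_eq_sinh_div_cosh
  rw [heq]
  refine h.congr_deriv ?_
  congr 1
  linarith [Real.cosh_sq x]

theorem strictMono_real_tanh : StrictMono Real.tanh :=
  strictMono_of_hasDerivAt_pos hasDerivAt_real_tanh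
    fun x => by have := Real.cosh_pos x; positivity

end Calculus

/-- The closed loop `ṙ = v cos φ`, `φ̇ = -A cos φ - B T(r) - (v/r) sin φ` with a saturating
increasing feedback `T` vanishing at `rd`, whose equilibrium radius is `re`. -/
structure ClosedLoop (v A B K rd re t0 : ℝ) (T T' r φ : ℝ → ℝ) : Prop where
  v_pos : 0 < v
  B_pos : 0 < B
  B_lt_A : B < A
  rd_pos : 0 < rd
  re_pos : 0 < re
  mono : StrictMono T
  deriv_T : ∀ x, HasDerivAt T (T' x) x
  deriv_T_le : ∀ x, |T' x| ≤ K
  abs_T_lt : ∀ x, |T x| < 1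
  T_rd : T rd = 0
  T_re : T re = v / (B * re)
  r_pos : ∀ t, t0 ≤ t → 0 < r t
  phi_init : φ t0 ∈ Set.Icc (-π) 0
  deriv_r : ∀ t, t0 ≤ t → HasDerivAt r (v * Real.cos (φ t)) t
  deriv_phi : ∀ t, t0 ≤ t →
    HasDerivAt φ (-A * Real.cos (φ t) - B * T (r t) - v / r t * Real.sin (φ t)) t

namespace ClosedLoop

variable {v A B K rd re t0 : ℝ} {T T' r φ : ℝ → ℝ}

theorem abs_B_mul_T_lt (h : ClosedLoop v A B K rd re t0 T T' r φ) (x : ℝ) : |B * T x| < B := by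
  rw [abs_mul, abs_of_pos h.B_pos]
  exact mul_lt_of_lt_one_right h.B_pos (h.abs_T_lt x)

theorem phi_mem (h : ClosedLoop v A B K rd re t0 T T' r φ) {t : ℝ} (ht : t0 ≤ t) :
    φ t ∈ Set.Icc (-π) 0 := by
  constructor
  · have := le_const_of_hasDerivAt_neg (f := fun t => -φ t) (c := π)
      (fun t ht => (h.deriv_phi t ht).fun_neg) (by linarith [h.phi_init.1])
      (fun t _ hc => by
        have hφ : φ t = -π := by linarith
        have := abs_lt.1 (h.abs_B_mul_T_lt (r t))
        rw [hφ, Real.cos_neg, Real.sin_neg, Real.cos_pi, Real.sin_pi]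
        linarith [h.B_lt_A, this.1, this.2]) ht
    linarith
  · exact le_const_of_hasDerivAt_neg h.deriv_phi h.phi_init.2
      (fun t _ hc => by
        have := abs_lt.1 (h.abs_B_mul_T_lt (r t))
        rw [hc, Real.cos_zero, Real.sin_zero]
        linarith [h.B_lt_A, this.1, this.2]) ht

theorem phi_mem_Ioo (h : ClosedLoop v A B K rd re t0 T T' r φ) {t : ℝ} (ht : t0 < t) :
    φ t ∈ Set.Ioo (-π) 0 := by
  have hev : ∀ᶠ s in nhds t, t0 ≤ s := (lt_mem_nhds ht).mono fun _ => le_of_lt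
  have hT := abs_lt.1 (h.abs_B_mul_T_lt (r t))
  have hmem := h.phi_mem ht.le
  refine ⟨lt_of_le_of_ne hmem.1 fun heq => ?_, lt_of_le_of_ne hmem.2 fun heq => ?_⟩
  · have hmin : IsLocalMin φ t := by
      filter_upwards [hev] with s hs
      rw [← heq]
      exact (h.phi_mem hs).1
    have := hmin.hasDerivAt_eq_zero (h.deriv_phi t ht.le)
    rw [← heq, Real.cos_neg, Real.sin_neg, Real.cos_pi, Real.sin_pi] at this
    linarith [h.B_lt_A, hT.1, hT.2]
  · have hmax : IsLocalMax φ t := by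
      filter_upwards [hev] with s hs
      rw [heq]
      exact (h.phi_mem hs).2
    have := hmax.hasDerivAt_eq_zero (h.deriv_phi t ht.le)
    rw [heq, Real.cos_zero, Real.sin_zero] at this
    linarith [h.B_lt_A, hT.1, hT.2]

theorem sin_neg (h : ClosedLoop v A B K rd re t0 T T' r φ) {t : ℝ} (ht : t0 < t) :
    Real.sin (φ t) < 0 :=
  Real.sin_neg_of_neg_of_neg_pi_lt (h.phi_mem_Ioo ht).2 (h.phi_mem_Ioo ht).1

/-- The derivative of the signed impact parameter `r sin φ`. -/
theorem hasDerivAt_mul_sin (h : ClosedLoop v A B K rd re t0 T T' r φ) {t : ℝ} (ht : t0 ≤ t) :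
    HasDerivAt (fun t => r t * Real.sin (φ t))
      (-(r t * Real.cos (φ t) * (A * Real.cos (φ t) + B * T (r t)))) t := by
  have hr := (h.r_pos t ht).ne'
  refine ((h.deriv_r t ht).fun_mul (h.deriv_phi t ht).sin).congr_deriv ?_
  field_simp
  ring

/-- The derivative of the Lyapunov function. -/
theorem hasDerivAt_lyapunov (h : ClosedLoop v A B K rd re t0 T T' r φ) {G : ℝ → ℝ}
    (hG : ∀ x, HasDerivAt G (B / v * (x * T x)) x) {t : ℝ} (ht : t0 ≤ t) :
    HasDerivAt (fun t => r t * Real.sin (φ t) + G (r t))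
      (-A * (r t * Real.cos (φ t) ^ 2)) t := by
  have hv := h.v_pos.ne'
  refine ((h.hasDerivAt_mul_sin ht).fun_add
    ((hG (r t)).comp t (h.deriv_r t ht))).congr_deriv ?_
  field_simp
  ring

theorem antitoneOn_lyapunov (h : ClosedLoop v A B K rd re t0 T T' r φ) {G : ℝ → ℝ}
    (hG : ∀ x, HasDerivAt G (B / v * (x * T x)) x) :
    AntitoneOn (fun t => r t * Real.sin (φ t) + G (r t)) (Set.Ici t0) :=
  antitoneOn_Ici_of_hasDerivAt (fun _ ht => h.hasDerivAt_lyapunov hG ht) fun t ht => by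
    have hA := h.B_pos.trans h.B_lt_A
    have := mul_nonneg hA.le (mul_nonneg (h.r_pos t ht).le (sq_nonneg (Real.cos (φ t))))
    linarith

theorem potential_nonneg (h : ClosedLoop v A B K rd re t0 T T' r φ) {G : ℝ → ℝ}
    (hG : ∀ x, HasDerivAt G (B / v * (x * T x)) x) (hG0 : G rd = 0) {x : ℝ} (hx : 0 < x) :
    0 ≤ G x := by
  have hB := h.B_pos
  have hv := h.v_pos
  rw [← hG0]
  refine le_of_hasDerivAt_of_sign h.rd_pos (fun x _ => hG x) (fun x hx hxr => ?_)
    (fun x hxr => ?_) hx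
  · have := h.mono.monotone hxr
    rw [h.T_rd] at this
    exact mul_nonpos_of_nonneg_of_nonpos (by positivity)
      (mul_nonpos_of_nonneg_of_nonpos hx.le this)
  · have := h.mono.monotone hxr
    rw [h.T_rd] at this
    exact mul_nonneg (by positivity) (mul_nonneg (h.rd_pos.le.trans hxr) this)

theorem potential_sub_ge (h : ClosedLoop v A B K rd re t0 T T' r φ) {G : ℝ → ℝ}
    (hG : ∀ x, HasDerivAt G (B / v * (x * T x)) x) {x : ℝ} (hx : 0 < x) :
    G re - re + (x - re) ^ 2 / (2 * re) ≤ G x - x := by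
  have hB := h.B_pos
  have hv := h.v_pos
  have hre := h.re_pos
  have hF : ∀ x, HasDerivAt (fun x => G x - x - (x - re) ^ 2 / (2 * re))
      (B / v * (x * (T x - T re))) x := by
    intro x
    refine (((hG x).fun_sub (hasDerivAt_id' x)).fun_sub
      ((((hasDerivAt_id' x).sub_const re).fun_pow 2).div_const (2 * re))).congr_deriv ?_
    rw [h.T_re]
    field_simp
    ring
  have := le_of_hasDerivAt_of_sign hre (fun x _ => hF x) (fun x hx hxr => ?_)
    (fun x hxr => ?_) hx
  · simp only [sub_self] at this
    norm_num at this
    linarith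
  · have := h.mono.monotone hxr
    exact mul_nonpos_of_nonneg_of_nonpos (by positivity)
      (mul_nonpos_of_nonneg_of_nonpos hx.le (by linarith))
  · have := h.mono.monotone hxr
    exact mul_nonneg (by positivity) (mul_nonneg (hre.le.trans hxr) (by linarith))

/-- A trajectory that stays inside the target circle stays away from the source. -/
theorem exists_pos_le_of_inside (h : ClosedLoop v A B K rd re t0 T T' r φ) {t1 : ℝ}
    (ht1 : t0 < t1) (hin : ∀ t, t1 ≤ t → r t < rd) :
    ∃ δ, 0 < δ ∧ ∃ t2, t0 ≤ t2 ∧ ∀ t, t2 ≤ t → δ ≤ r t := by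
  have hA := h.B_pos.trans h.B_lt_A
  have hT : ∀ t, t1 ≤ t → B * T (r t) ≤ 0 := fun t ht =>
    mul_nonpos_of_nonneg_of_nonpos h.B_pos.le (h.T_rd ▸ (h.mono (hin t ht)).le)
  by_cases hout : ∃ t2, t1 ≤ t2 ∧ -(π / 2) ≤ φ t2
  · obtain ⟨t2, ht2, hφ2⟩ := hout
    have ht02 : t0 ≤ t2 := ht1.le.trans ht2
    have hφ : ∀ t, t2 ≤ t → -φ t ≤ π / 2 := fun t ht =>
      le_const_of_hasDerivAt_neg (f := fun t => -φ t)
        (fun t ht => (h.deriv_phi t (ht02.trans ht)).fun_neg) (by linarith)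
        (fun t ht hc => by
          have hφ : φ t = -(π / 2) := by linarith
          have h1 := hT t (ht2.trans ht)
          have h2 := div_pos h.v_pos (h.r_pos t (ht02.trans ht))
          rw [hφ, Real.cos_neg, Real.sin_neg, Real.cos_pi_div_two, Real.sin_pi_div_two]
          linarith) ht
    refine ⟨r t2, h.r_pos t2 ht02, t2, ht02, fun t ht => ?_⟩
    refine monotoneOn_Ici_of_hasDerivAt (fun t ht => h.deriv_r t (ht02.trans ht))
      (fun t ht => mul_nonneg h.v_pos.le (Real.cos_nonneg_of_neg_pi_div_two_le_of_le ?_ ?_))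
      Set.self_mem_Ici ht ht
    · linarith [hφ t ht]
    · linarith [(h.phi_mem (ht02.trans ht)).2, Real.pi_pos]
  · push Not at hout
    have hcos : ∀ t, t1 ≤ t → Real.cos (φ t) ≤ 0 := fun t ht => by
      rw [← Real.cos_neg]
      exact Real.cos_nonpos_of_pi_div_two_le_of_le (by linarith [hout t ht])
        (by linarith [(h.phi_mem (ht1.le.trans ht)).1, Real.pi_pos])
    have hanti := antitoneOn_Ici_of_hasDerivAt
      (fun t ht => h.hasDerivAt_mul_sin (ht1.le.trans ht)) (fun t ht => by
        have h1 : A * Real.cos (φ t) + B * T (r t) ≤ 0 :=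
          add_nonpos (mul_nonpos_of_nonneg_of_nonpos hA.le (hcos t ht)) (hT t ht)
        have h2 : r t * Real.cos (φ t) ≤ 0 :=
          mul_nonpos_of_nonneg_of_nonpos (h.r_pos t (ht1.le.trans ht)).le (hcos t ht)
        linarith [mul_nonneg_of_nonpos_of_nonpos h2 h1])
    refine ⟨-(r t1 * Real.sin (φ t1)), ?_, t1, ht1.le, fun t ht => ?_⟩
    · linarith [mul_neg_of_pos_of_neg (h.r_pos t1 ht1.le) (h.sin_neg ht1)]
    · have h1 : r t * Real.sin (φ t) ≤ r t1 * Real.sin (φ t1) := hanti Set.self_mem_Ici ht ht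
      have h2 := mul_le_mul_of_nonneg_left (Real.neg_one_le_sin (φ t))
        (h.r_pos t (ht1.le.trans ht)).le
      linarith

theorem exists_pos_le (h : ClosedLoop v A B K rd re t0 T T' r φ) {G : ℝ → ℝ}
    (hG : ∀ x, HasDerivAt G (B / v * (x * T x)) x) (hG0 : G rd = 0) :
    ∃ δ, 0 < δ ∧ ∃ t2, t0 ≤ t2 ∧ ∀ t, t2 ≤ t → δ ≤ r t := by
  by_cases hcross : ∃ t1, t0 < t1 ∧ r t1 = rd
  · obtain ⟨t1, ht1, hr1⟩ := hcross
    refine ⟨-(rd * Real.sin (φ t1)), ?_, t1, ht1.le, fun t ht => ?_⟩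
    · linarith [mul_neg_of_pos_of_neg h.rd_pos (h.sin_neg ht1)]
    · have hr := h.r_pos t (ht1.le.trans ht)
      have h1 : r t * Real.sin (φ t) + G (r t) ≤ r t1 * Real.sin (φ t1) + G (r t1) :=
        h.antitoneOn_lyapunov hG ht1.le (ht1.le.trans ht) ht
      have h2 := mul_le_mul_of_nonneg_left (Real.neg_one_le_sin (φ t)) hr.le
      have h3 := h.potential_nonneg hG hG0 hr
      rw [hr1, hG0] at h1
      linarith
  · push Not at hcross
    have ht1 : t0 < t0 + 1 := by linarith
    have hcont : ContinuousOn r (Set.Ici (t0 + 1)) := fun t ht =>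
      (h.deriv_r t (ht1.le.trans ht)).continuousAt.continuousWithinAt
    rcases lt_or_gt_of_ne (hcross _ ht1) with hlt | hgt
    · refine h.exists_pos_le_of_inside ht1 fun t ht => ?_
      by_contra! hle
      obtain ⟨s, hs, hsr⟩ := isPreconnected_Ici.intermediate_value
        (Set.self_mem_Ici (a := t0 + 1)) ht hcont ⟨hlt.le, hle⟩
      exact hcross s (ht1.trans_le hs) hsr
    · refine ⟨rd, h.rd_pos, t0 + 1, ht1.le, fun t ht => ?_⟩
      by_contra! hle
      obtain ⟨s, hs, hsr⟩ := isPreconnected_Ici.intermediate_value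
        ht (Set.self_mem_Ici (a := t0 + 1)) hcont ⟨hle.le, hgt.le⟩
      exact hcross s (ht1.trans_le hs) hsr

theorem lyapunov_ge (h : ClosedLoop v A B K rd re t0 T T' r φ) {G : ℝ → ℝ}
    (hG : ∀ x, HasDerivAt G (B / v * (x * T x)) x) {t : ℝ} (ht : t0 ≤ t) :
    G re - re + (r t - re) ^ 2 / (2 * re) ≤ r t * Real.sin (φ t) + G (r t) := by
  have h1 := mul_le_mul_of_nonneg_left (Real.neg_one_le_sin (φ t)) (h.r_pos t ht).le
  linarith [h.potential_sub_ge hG (h.r_pos t ht)]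

theorem exists_le (h : ClosedLoop v A B K rd re t0 T T' r φ) {G : ℝ → ℝ}
    (hG : ∀ x, HasDerivAt G (B / v * (x * T x)) x) :
    ∃ R, ∀ t, t0 ≤ t → r t ≤ R := by
  have hre := h.re_pos
  set C := r t0 * Real.sin (φ t0) + G (r t0) - (G re - re) with hC
  refine ⟨re + (2 * re * C + 1), fun t ht => ?_⟩
  have h1 : r t * Real.sin (φ t) + G (r t) ≤ r t0 * Real.sin (φ t0) + G (r t0) :=
    h.antitoneOn_lyapunov hG Set.self_mem_Ici ht ht
  have h2 := h.lyapunov_ge hG ht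
  have h3 : (r t - re) ^ 2 / (2 * re) ≤ C := by linarith
  rw [div_le_iff₀ (by positivity)] at h3
  nlinarith [sq_nonneg (r t - re - 1)]

theorem abs_deriv_phi_le (h : ClosedLoop v A B K rd re t0 T T' r φ) {δ t : ℝ} (hδ : 0 < δ)
    (hr : δ ≤ r t) :
    |-A * Real.cos (φ t) - B * T (r t) - v / r t * Real.sin (φ t)| ≤ A + B + v / δ := by
  have hA := h.B_pos.trans h.B_lt_A
  have hv := h.v_pos
  have h1 : |-A * Real.cos (φ t)| ≤ A := by
    rw [abs_mul, abs_neg, abs_of_pos hA]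
    exact mul_le_of_le_one_right hA.le (Real.abs_cos_le_one _)
  have h2 : |v / r t * Real.sin (φ t)| ≤ v / δ := by
    rw [abs_mul, abs_of_pos (div_pos hv (hδ.trans_le hr))]
    exact (mul_le_of_le_one_right (div_pos hv (hδ.trans_le hr)).le (Real.abs_sin_le_one _)).trans
      (div_le_div_of_nonneg_left hv.le hδ hr)
  exact (abs_sub _ _).trans (add_le_add ((abs_sub _ _).trans
    (add_le_add h1 (h.abs_B_mul_T_lt _).le)) h2)

theorem tendsto_cos (h : ClosedLoop v A B K rd re t0 T T' r φ) {G : ℝ → ℝ}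
    (hG : ∀ x, HasDerivAt G (B / v * (x * T x)) x) {δ R t2 : ℝ} (hδ : 0 < δ) (ht2 : t0 ≤ t2)
    (hlow : ∀ t, t2 ≤ t → δ ≤ r t) (hup : ∀ t, t0 ≤ t → r t ≤ R) :
    Tendsto (fun t => Real.cos (φ t)) atTop (nhds 0) := by
  have hA := h.B_pos.trans h.B_lt_A
  have hv := h.v_pos
  obtain ⟨L, hL⟩ := exists_tendsto_of_antitoneOn_Ici (m := G re - re)
    (h.antitoneOn_lyapunov hG) (fun t ht => by
      have h0 : 0 ≤ (r t - re) ^ 2 / (2 * re) :=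
        div_nonneg (sq_nonneg _) (by linarith [h.re_pos])
      linarith [h.lyapunov_ge hG ht])
  set P : ℝ → ℝ := fun t => -A * Real.cos (φ t) - B * T (r t) - v / r t * Real.sin (φ t) with hP
  have hd := tendsto_deriv_zero_of_bounded_second_deriv (a := t2)
    (M := A * (v + R * (2 * (A + B + v / δ))))
    (fun t ht => h.hasDerivAt_lyapunov hG (ht2.trans ht))
    (fun t ht => ((h.deriv_r t (ht2.trans ht)).fun_mul
      ((h.deriv_phi t (ht2.trans ht)).cos.fun_pow 2)).const_mul (-A)) (fun t ht => by
      have hp := h.abs_deriv_phi_le hδ (hlow t ht)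
      have hr := h.r_pos t (ht2.trans ht)
      have hR := hup t (ht2.trans ht)
      have hc := Real.abs_cos_le_one (φ t)
      have hs := Real.abs_sin_le_one (φ t)
      have hc3 : |Real.cos (φ t) * Real.cos (φ t) ^ 2| ≤ 1 := by
        rw [abs_mul, abs_pow]
        exact mul_le_one₀ hc (by positivity) (pow_le_one₀ (abs_nonneg _) hc)
      have hcs : |Real.cos (φ t) * Real.sin (φ t)| ≤ 1 := by
        rw [abs_mul]
        exact mul_le_one₀ hc (abs_nonneg _) hs
      rw [abs_mul, abs_neg, abs_of_pos hA]
      refine mul_le_mul_of_nonneg_left ((abs_add_le _ _).trans (add_le_add ?_ ?_)) hA.le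
      · rw [mul_assoc, abs_mul, abs_of_pos hv]
        exact mul_le_of_le_one_right hv.le hc3
      · rw [abs_mul, abs_of_pos hr]
        refine mul_le_mul hR ?_ (abs_nonneg _) (hr.le.trans hR)
        have : |Real.cos (φ t) * Real.sin (φ t)| * |P t| ≤ 1 * (A + B + v / δ) :=
          mul_le_mul hcs hp (abs_nonneg _) zero_le_one
        rw [← abs_mul, one_mul] at this
        calc _ = |2 * (Real.cos (φ t) * Real.sin (φ t) * P t)| := by
              rw [← abs_neg, hP]
              congr 1
              ring
          _ ≤ _ := by
              rw [abs_mul, abs_two]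
              linarith) hL
  have hsq : Tendsto (fun t => Real.cos (φ t) ^ 2) atTop (nhds 0) := by
    have hlim := hd.const_mul (-(A * δ)⁻¹)
    rw [mul_zero] at hlim
    refine squeeze_zero' (Eventually.of_forall fun t => sq_nonneg _) ?_ hlim
    filter_upwards [eventually_ge_atTop t2] with t ht
    have h1 := mul_le_mul_of_nonneg_right (hlow t ht) (sq_nonneg (Real.cos (φ t)))
    have h2 : -(A * δ)⁻¹ * (-A * (r t * Real.cos (φ t) ^ 2)) = r t * Real.cos (φ t) ^ 2 / δ := by
      field_simp
    rw [h2, le_div_iff₀ hδ]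
    linarith
  have := hsq.sqrt
  simp only [Real.sqrt_sq_eq_abs, Real.sqrt_zero] at this
  exact (tendsto_zero_iff_abs_tendsto_zero _).2 this

theorem tendsto_phi (h : ClosedLoop v A B K rd re t0 T T' r φ)
    (hcos : Tendsto (fun t => Real.cos (φ t)) atTop (nhds 0)) :
    Tendsto φ atTop (nhds (-(π / 2))) := by
  have := (Real.continuous_arccos.continuousAt.tendsto.comp hcos).neg
  rw [Real.arccos_zero] at this
  refine this.congr' ?_
  filter_upwards [eventually_ge_atTop t0] with t ht
  have hmem := h.phi_mem ht
  rw [Function.comp_apply, ← Real.cos_neg,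
    Real.arccos_cos (by linarith [hmem.2]) (by linarith [hmem.1]), neg_neg]

theorem tendsto_deriv_phi (h : ClosedLoop v A B K rd re t0 T T' r φ) {δ t2 : ℝ} (hδ : 0 < δ)
    (ht2 : t0 ≤ t2) (hlow : ∀ t, t2 ≤ t → δ ≤ r t)
    (hφ : Tendsto φ atTop (nhds (-(π / 2)))) :
    Tendsto (fun t => -A * Real.cos (φ t) - B * T (r t) - v / r t * Real.sin (φ t))
      atTop (nhds 0) := by
  have hA := h.B_pos.trans h.B_lt_A
  have hB := h.B_pos
  have hv := h.v_pos
  set Q := A + B + v / δ with hQ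
  refine tendsto_deriv_zero_of_bounded_second_deriv (a := t2)
    (M := A * Q + B * (K * v) + (v * v / δ ^ 2 + v / δ * Q))
    (fun t ht => h.deriv_phi t (ht2.trans ht))
    (fun t ht => (((h.deriv_phi t (ht2.trans ht)).cos.const_mul (-A)).fun_sub
      (((h.deriv_T (r t)).comp t (h.deriv_r t (ht2.trans ht))).const_mul B)).fun_sub
      (((hasDerivAt_const t v).fun_div (h.deriv_r t (ht2.trans ht))
        (h.r_pos t (ht2.trans ht)).ne').fun_mul (h.deriv_phi t (ht2.trans ht)).sin))
    (fun t ht => ?_) hφ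
  have hp := h.abs_deriv_phi_le hδ (hlow t ht)
  set P := -A * Real.cos (φ t) - B * T (r t) - v / r t * Real.sin (φ t)
  have hr := h.r_pos t (ht2.trans ht)
  have hc := Real.abs_cos_le_one (φ t)
  have hs := Real.abs_sin_le_one (φ t)
  refine (abs_sub _ _).trans (add_le_add ((abs_sub _ _).trans (add_le_add ?_ ?_))
    ((abs_add_le _ _).trans (add_le_add ?_ ?_)))
  · rw [abs_mul, abs_neg, abs_of_pos hA, abs_mul, abs_neg]
    refine mul_le_mul_of_nonneg_left ?_ hA.le
    calc _ ≤ 1 * Q := mul_le_mul hs hp (abs_nonneg _) zero_le_one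
      _ = Q := one_mul Q
  · rw [abs_mul, abs_of_pos hB, abs_mul, abs_mul, abs_of_pos hv]
    refine mul_le_mul_of_nonneg_left (mul_le_mul (h.deriv_T_le _)
      (mul_le_of_le_one_right hv.le hc) (by positivity)
      ((abs_nonneg _).trans (h.deriv_T_le (r t)))) hB.le
  · rw [zero_mul, zero_sub, abs_mul, abs_div, abs_neg, abs_mul, abs_mul, abs_of_pos hv,
      abs_of_pos (pow_pos hr 2)]
    calc _ ≤ v * v / δ ^ 2 * 1 := by
          refine mul_le_mul ?_ hs (abs_nonneg _) (by positivity)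
          refine div_le_div₀ (by positivity) ?_ (by positivity)
            (pow_le_pow_left₀ hδ.le (hlow t ht) 2)
          exact mul_le_mul_of_nonneg_left (mul_le_of_le_one_right hv.le hc) hv.le
      _ = _ := mul_one _
  · rw [abs_mul, abs_mul, abs_of_pos (div_pos hv hr)]
    refine mul_le_mul (div_le_div_of_nonneg_left hv.le hδ (hlow t ht)) ?_ (by positivity)
      (by positivity)
    calc _ ≤ 1 * Q := mul_le_mul hc hp (abs_nonneg _) zero_le_one
      _ = Q := one_mul Q

/-- The radial balance `v / x - B T(x)` is strictly decreasing on `(0, ∞)`. -/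
theorem strictAntiOn_balance (h : ClosedLoop v A B K rd re t0 T T' r φ) :
    StrictAntiOn (fun x => v / x - B * T x) (Set.Ioi 0) := fun _ hx _ _ hxy =>
  sub_lt_sub (div_lt_div_of_pos_left h.v_pos hx hxy)
    (mul_lt_mul_of_pos_left (h.mono hxy) h.B_pos)

theorem balance_re (h : ClosedLoop v A B K rd re t0 T T' r φ) : v / re - B * T re = 0 := by
  have := h.B_pos.ne'
  have := h.re_pos.ne'
  rw [h.T_re]
  field_simp
  ring

theorem tendsto_r (h : ClosedLoop v A B K rd re t0 T T' r φ)
    (hbal : Tendsto (fun t => v / r t - B * T (r t)) atTop (nhds 0)) :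
    Tendsto r atTop (nhds re) := by
  have hre := h.re_pos
  have hanti := h.strictAntiOn_balance
  have hpos : ∀ᶠ t in atTop, 0 < r t := by
    filter_upwards [eventually_ge_atTop t0] with t ht using h.r_pos t ht
  rw [tendsto_order]
  constructor
  · intro x hx
    have hm : 0 < max x (re / 2) := lt_max_of_lt_right (by linarith)
    have hlt : max x (re / 2) < re := max_lt hx (by linarith)
    have hval := hanti hm hre hlt
    simp only [h.balance_re] at hval
    filter_upwards [hbal.eventually_lt_const hval, hpos] with t ht hrt
    exact (le_max_left _ _).trans_lt ((hanti.lt_iff_gt hrt hm).1 ht)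
  · intro x hx
    have hval := hanti hre (hre.trans hx) hx
    simp only [h.balance_re] at hval
    filter_upwards [hbal.eventually_const_lt hval, hpos] with t ht hrt
    exact (hanti.lt_iff_gt (hre.trans hx) hrt).1 ht

theorem tendsto_balance (h : ClosedLoop v A B K rd re t0 T T' r φ) {δ t2 : ℝ} (hδ : 0 < δ)
    (hlow : ∀ t, t2 ≤ t → δ ≤ r t) (hφ : Tendsto φ atTop (nhds (-(π / 2))))
    (hd : Tendsto (fun t => -A * Real.cos (φ t) - B * T (r t) - v / r t * Real.sin (φ t))
      atTop (nhds 0)) :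
    Tendsto (fun t => v / r t - B * T (r t)) atTop (nhds 0) := by
  have hv := h.v_pos
  have hcos := (Real.continuous_cos.tendsto _).comp hφ
  have hsin := (Real.continuous_sin.tendsto _).comp hφ
  rw [Real.cos_neg, Real.cos_pi_div_two] at hcos
  rw [Real.sin_neg, Real.sin_pi_div_two] at hsin
  have hprod : Tendsto (fun t => v / r t * (1 + Real.sin (φ t))) atTop (nhds 0) := by
    have hlim := (hsin.const_add 1).const_mul (v / δ)
    rw [add_neg_cancel, mul_zero] at hlim
    refine squeeze_zero' ?_ ?_ hlim
    · filter_upwards [eventually_ge_atTop t2] with t ht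
      have := hδ.trans_le (hlow t ht)
      exact mul_nonneg (by positivity) (by linarith [Real.neg_one_le_sin (φ t)])
    · filter_upwards [eventually_ge_atTop t2] with t ht
      exact mul_le_mul_of_nonneg_right (div_le_div_of_nonneg_left hv.le hδ (hlow t ht))
        (by linarith [Real.neg_one_le_sin (φ t)])
  have := (hd.add (hcos.const_mul A)).add hprod
  simp only [mul_zero, add_zero] at this
  refine this.congr fun t => ?_
  simp only [Function.comp_apply]
  ring

/-- Every trajectory of the closed loop circles the source at the equilibrium radius in the
limit. -/
theorem tendsto_equilibrium (h : ClosedLoop v A B K rd re t0 T T' r φ) :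
    Tendsto r atTop (nhds re) ∧ Tendsto (fun t => Real.cos (φ t)) atTop (nhds 0) := by
  have hT : Continuous T := continuous_iff_continuousAt.2 fun x => (h.deriv_T x).continuousAt
  obtain ⟨G, hG0, hG⟩ := exists_hasDerivAt_of_continuous
    (f := fun x => B / v * (x * T x)) (by fun_prop) rd
  obtain ⟨δ, hδ, t2, ht2, hlow⟩ := h.exists_pos_le hG hG0
  obtain ⟨R, hup⟩ := h.exists_le hG
  have hcos := h.tendsto_cos hG hδ ht2 hlow hup
  have hφ := h.tendsto_phi hcos
  exact ⟨h.tendsto_r (h.tendsto_balance hδ hlow hφ (h.tendsto_deriv_phi hδ ht2 hlow hφ)), hcos⟩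

end ClosedLoop

/-- Asymptotic convergence for the P-like controller in a circular field: if
`φ(t0) ∈ [-π, 0]`, then `s(t) → s_e` and `ṡ(t) = -α v cos φ(t) → 0` as `t → ∞`,
where `s_e = s_d - α(r_e - r_d)` and `r_e` is the unique positive root of
`g(r) = -tanh(α(r - r_d)/c4) + v/(c1 c3 r)`. -/
theorem stmt_9 (v α rd c1 c3 c4 sd t0 : ℝ)
    (hv : 0 < v) (hα : 0 < α) (hrd : 0 < rd) (hc4 : 0 < c4) (hc1 : 0 < c1)
    (hc3 : 0 < c3) (hc3' : c3 < α * v)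
    (r φ : ℝ → ℝ)
    (hrpos : ∀ t : ℝ, t0 ≤ t → 0 < r t)
    (hφ0 : φ t0 ∈ Set.Icc (-π) 0)
    (hdr : ∀ t : ℝ, t0 ≤ t → HasDerivAt r (v * Real.cos (φ t)) t)
    (hdφ : ∀ t : ℝ, t0 ≤ t → HasDerivAt φ
      (c1 * (-(α * v) * Real.cos (φ t) - c3 * Real.tanh (α * (r t - rd) / c4))
        - (v / r t) * Real.sin (φ t)) t)
    (s : ℝ → ℝ) (hs : ∀ t : ℝ, s t = sd - α * (r t - rd))
    (re : ℝ) (hre : 0 < re)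
    (hroot : -Real.tanh (α * (re - rd) / c4) + v / (c1 * c3 * re) = 0)
    (se : ℝ) (hse : se = sd - α * (re - rd)) :
    Tendsto s atTop (nhds se) ∧
    Tendsto (fun t => -α * v * Real.cos (φ t)) atTop (nhds 0) := by
  have hloop : ClosedLoop v (c1 * (α * v)) (c1 * c3) (α / c4) rd re t0
      (fun x => Real.tanh (α * (x - rd) / c4))
      (fun x => 1 / Real.cosh (α * (x - rd) / c4) ^ 2 * (α / c4)) r φ :=
    { v_pos := hv
      B_pos := mul_pos hc1 hc3
      B_lt_A := mul_lt_mul_of_pos_left hc3' hc1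
      rd_pos := hrd
      re_pos := hre
      mono := fun x y hxy => strictMono_real_tanh (by gcongr)
      deriv_T := fun x => by
        have := ((((hasDerivAt_id' x).sub_const rd).const_mul α).div_const c4)
        rw [mul_one] at this
        exact (hasDerivAt_real_tanh _).comp x this
      deriv_T_le := fun x => by
        have hcosh := Real.one_le_cosh (α * (x - rd) / c4)
        rw [abs_of_nonneg (by positivity)]
        exact mul_le_of_le_one_left (by positivity)
          (div_le_one_of_le₀ (one_le_pow₀ hcosh) (by positivity))
      abs_T_lt := fun x => Real.abs_tanh_lt_one _
      T_rd := by simp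
      T_re := by linarith
      r_pos := hrpos
      phi_init := hφ0
      deriv_r := hdr
      deriv_phi := fun t ht => by
        refine (hdφ t ht).congr_deriv ?_
        ring }
  obtain ⟨hr, hcos⟩ := hloop.tendsto_equilibrium
  constructor
  · rw [funext hs, hse]
    exact ((hr.sub_const rd).const_mul α).const_sub sd
  · simpa using hcos.const_mul (-α * v)
end
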